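/- Under the hypotheses of Theorem 1 (A(u) = C⁻¹ diag(a_1(u),…,a_n(u)) C with C orthogonal and a_j(u) > 0 μ-measurable, u ↦ |Φ(u)|(a_1(u)⋯a_n(u))^{-1/2} μ-integrable, T a continuous linear operator on L²(ℝⁿ;ℂ) with (Tf)(x) = ∫_Ω Φ(u) f(A(u)x) dμ(u) a.e. for all f ∈ L²), the operator T is bijective (invertible in the algebra of bounded operators on L²(ℝⁿ;ℂ)) if and only if inf_{s ∈ ℝⁿ} |φ(s)| > 0, where φ is the symbol of T. -/

import Mathlib

open MeasureTheory Complex Filter Matrix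
open scoped ENNReal ComplexConjugate

/-- The logarithmic chart of the orthant with signs `ε` in the coordinates given by `C`. -/
noncomputable def orthantChart {n : ℕ} (C : Matrix (Fin n) (Fin n) ℝ) (ε : Fin n → ℤˣ)
    (y : EuclideanSpace ℝ (Fin n)) : Fin n → ℝ :=
  Cᵀ *ᵥ fun j => ((ε j : ℤ) : ℝ) * Real.exp (y j)

/-- The common inverse of the logarithmic charts. -/
noncomputable def orthantCoord {n : ℕ} (C : Matrix (Fin n) (Fin n) ℝ) (x : Fin n → ℝ) :
    EuclideanSpace ℝ (Fin n) :=
  WithLp.toLp 2 fun j => Real.log ((C *ᵥ x) j)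

/-- The open orthant with signs `ε` in the coordinates given by `C`. -/
def orthant {n : ℕ} (C : Matrix (Fin n) (Fin n) ℝ) (ε : Fin n → ℤˣ) : Set (Fin n → ℝ) :=
  {x | ∀ j, 0 < ((ε j : ℤ) : ℝ) * (C *ᵥ x) j}

section Charts

variable {n : ℕ} {C : Matrix (Fin n) (Fin n) ℝ}

lemma mulVec_orthantChart (hC : C * Cᵀ = 1) (ε : Fin n → ℤˣ) (y : EuclideanSpace ℝ (Fin n)) :
    C *ᵥ orthantChart C ε y = fun j => ((ε j : ℤ) : ℝ) * Real.exp (y j) := by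
  rw [orthantChart, Matrix.mulVec_mulVec, hC, Matrix.one_mulVec]

lemma orthantCoord_orthantChart (hC : C * Cᵀ = 1) (ε : Fin n → ℤˣ)
    (y : EuclideanSpace ℝ (Fin n)) : orthantCoord C (orthantChart C ε y) = y := by
  ext j
  rw [orthantCoord, mulVec_orthantChart hC]
  rcases Int.units_eq_one_or (ε j) with h | h <;> simp [h]

lemma orthantChart_mem_orthant_iff (hC : C * Cᵀ = 1) (ε ε' : Fin n → ℤˣ)
    (y : EuclideanSpace ℝ (Fin n)) : orthantChart C ε y ∈ orthant C ε' ↔ ε' = ε := by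
  rw [orthant, Set.mem_ofPred_eq, mulVec_orthantChart hC, funext_iff]
  refine forall_congr' fun j => ?_
  have := Real.exp_pos (y j)
  rcases Int.units_eq_one_or (ε j) with h | h <;>
    rcases Int.units_eq_one_or (ε' j) with h' | h' <;> simp [h, h', this, this.le]

lemma orthantChart_orthantCoord (hC : C * Cᵀ = 1) {ε : Fin n → ℤˣ} {x : Fin n → ℝ}
    (hx : x ∈ orthant C ε) : orthantChart C ε (orthantCoord C x) = x := by
  have h : (fun j => ((ε j : ℤ) : ℝ) * Real.exp (orthantCoord C x j)) = C *ᵥ x := by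
    ext j
    have hj := hx j
    rcases Int.units_eq_one_or (ε j) with h | h
    · simp only [h, Units.val_one, Int.cast_one, one_mul] at hj ⊢
      exact Real.exp_log hj
    · simp only [h, Units.val_neg, Units.val_one, Int.cast_neg, Int.cast_one, neg_mul,
        one_mul, Left.neg_pos_iff] at hj ⊢
      simp [orthantCoord, Real.exp_log_of_neg hj]
  rw [orthantChart, h, Matrix.mulVec_mulVec, mul_eq_one_comm.mp hC, Matrix.one_mulVec]

lemma range_orthantChart (hC : C * Cᵀ = 1) (ε : Fin n → ℤˣ) :
    Set.range (orthantChart C ε) = orthant C ε := by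
  ext x
  constructor
  · rintro ⟨y, rfl⟩
    exact (orthantChart_mem_orthant_iff hC _ _ _).2 rfl
  · exact fun hx => ⟨_, orthantChart_orthantCoord hC hx⟩

lemma measurable_orthantChart (ε : Fin n → ℤˣ) : Measurable (orthantChart C ε) := by
  unfold orthantChart
  fun_prop

lemma measurable_mulVec : Measurable fun x : Fin n → ℝ => C *ᵥ x := by
  fun_prop

lemma measurable_orthantCoord : Measurable (orthantCoord C) := by
  unfold orthantCoord
  refine (WithLp.measurable_toLp 2 _).comp (measurable_pi_lambda _ fun j => ?_)
  exact ((measurable_pi_apply j).comp measurable_mulVec).log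

lemma measurableSet_orthant (ε : Fin n → ℤˣ) : MeasurableSet (orthant C ε) := by
  have : orthant C ε = ⋂ j, {x | 0 < ((ε j : ℤ) : ℝ) * (C *ᵥ x) j} := by
    ext; simp [orthant]
  rw [this]
  refine MeasurableSet.iInter fun j => measurableSet_lt measurable_const ?_
  exact ((measurable_pi_apply j).comp measurable_mulVec).const_mul _

lemma abs_det_of_mul_transpose_eq_one (hC : C * Cᵀ = 1) : |C.det| = 1 := by
  have h := congrArg Matrix.det hC
  rw [Matrix.det_mul, Matrix.det_transpose, Matrix.det_one] at h
  exact (abs_eq zero_le_one).2 (mul_self_eq_one_iff.mp h)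

lemma setLIntegral_orthant (hC : C * Cᵀ = 1) (ε : Fin n → ℤˣ) (F : (Fin n → ℝ) → ℝ≥0∞) :
    ∫⁻ x in orthant C ε, F x =
      ∫⁻ y : EuclideanSpace ℝ (Fin n),
        ENNReal.ofReal (Real.exp (∑ j, y j)) * F (orthantChart C ε y) := by
  set κ : (Fin n → ℝ) → (Fin n → ℝ) := fun y => orthantChart C ε (WithLp.toLp 2 y)
  let L : (Fin n → ℝ) → (Fin n → ℝ) →L[ℝ] (Fin n → ℝ) := fun y =>
    LinearMap.toContinuousLinearMap
      (Matrix.toLin' (Cᵀ * Matrix.diagonal fun j => ((ε j : ℤ) : ℝ) * Real.exp (y j)))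
  have hrange : κ '' Set.univ = orthant C ε := by
    rw [Set.image_univ, ← range_orthantChart hC]
    exact (WithLp.toLp_surjective 2).range_comp (orthantChart C ε)
  have hinj : Function.Injective κ := by
    intro x y h
    have := congrArg (orthantCoord C) h
    simpa [κ, orthantCoord_orthantChart hC] using this
  have hderiv : ∀ y, HasFDerivAt κ (L y) y := by
    intro y
    have h1 : HasFDerivAt (fun (y : Fin n → ℝ) j => ((ε j : ℤ) : ℝ) * Real.exp (y j))
        (ContinuousLinearMap.pi fun j => (((ε j : ℤ) : ℝ) * Real.exp (y j)) •
          (ContinuousLinearMap.proj j : (Fin n → ℝ) →L[ℝ] ℝ)) y := by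
      refine hasFDerivAt_pi.2 fun j => ?_
      have h2 : HasFDerivAt (fun y : Fin n → ℝ => y j)
        (ContinuousLinearMap.proj j : (Fin n → ℝ) →L[ℝ] ℝ) y := hasFDerivAt_apply j y
      have := h2.exp.const_mul (((ε j : ℤ) : ℝ))
      rwa [smul_smul] at this
    have h3 := (LinearMap.toContinuousLinearMap (Matrix.toLin' Cᵀ)).hasFDerivAt.comp y h1
    have hL : L y = (LinearMap.toContinuousLinearMap (Matrix.toLin' Cᵀ)).comp
        (ContinuousLinearMap.pi fun j => (((ε j : ℤ) : ℝ) * Real.exp (y j)) •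
          (ContinuousLinearMap.proj j : (Fin n → ℝ) →L[ℝ] ℝ)) := by
      ext1 v
      simp only [L, LinearMap.coe_toContinuousLinearMap', Matrix.toLin'_apply,
        ← Matrix.mulVec_mulVec, ContinuousLinearMap.comp_apply]
      congr 1
      ext j
      simp [Matrix.mulVec_diagonal]
    rw [hL]
    exact h3
  have hdet : ∀ y, |(L y).det| = Real.exp (∑ j, y j) := by
    intro y
    have : (L y).det = (Cᵀ * Matrix.diagonal fun j => ((ε j : ℤ) : ℝ) * Real.exp (y j)).det := by
      simp [L, ContinuousLinearMap.det]
    rw [this, Matrix.det_mul, Matrix.det_transpose, abs_mul, abs_det_of_mul_transpose_eq_one hC,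
      one_mul, Matrix.det_diagonal, Finset.abs_prod, Real.exp_sum]
    refine Finset.prod_congr rfl fun j _ => ?_
    rcases Int.units_eq_one_or (ε j) with h | h <;> simp [h]
  rw [← hrange, lintegral_image_eq_lintegral_abs_det_fderiv_mul volume MeasurableSet.univ
    (fun y _ => (hderiv y).hasFDerivWithinAt) hinj.injOn, Measure.restrict_univ,
    ← (EuclideanSpace.volume_preserving_symm_measurableEquiv_toLp (Fin n)).lintegral_comp_emb
      (MeasurableEquiv.measurableEmbedding _)]
  simp only [hdet]
  rfl

lemma ae_mem_orthant (hC : C * Cᵀ = 1) : ∀ᵐ x : Fin n → ℝ, ∃ ε, x ∈ orthant C ε := by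
  have h : ∀ j, ∀ᵐ x : Fin n → ℝ, (C *ᵥ x) j ≠ 0 := by
    intro j
    let p : Submodule ℝ (Fin n → ℝ) := LinearMap.ker (LinearMap.proj j ∘ₗ Matrix.toLin' C)
    have hp : p ≠ ⊤ := by
      intro htop
      have : Cᵀ *ᵥ Pi.single j 1 ∈ p := htop ▸ Submodule.mem_top
      simp only [p, LinearMap.mem_ker, LinearMap.comp_apply, Matrix.toLin'_apply,
        Matrix.mulVec_mulVec, hC, Matrix.one_mulVec] at this
      simp at this
    have := Measure.addHaar_submodule (volume : Measure (Fin n → ℝ)) p hp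
    rw [ae_iff]
    convert this using 2
    ext x
    simp [p]
  filter_upwards [ae_all_iff.2 h] with x hx
  refine ⟨fun j => if 0 < (C *ᵥ x) j then 1 else -1, fun j => ?_⟩
  by_cases hj : 0 < (C *ᵥ x) j
  · simp [hj]
  · have := lt_of_le_of_ne (not_lt.1 hj) (hx j)
    simpa [hj] using this

lemma ae_orthantChart (hC : C * Cᵀ = 1) (ε : Fin n → ℤˣ) {p : (Fin n → ℝ) → Prop}
    (hp : ∀ᵐ x, p x) : ∀ᵐ y, p (orthantChart C ε y) := by
  obtain ⟨N, hN, hNm, hN0⟩ := exists_measurable_superset_of_null (ae_iff.1 hp)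
  have h := setLIntegral_orthant hC ε (N.indicator 1)
  have h0 : ∫⁻ x in orthant C ε, N.indicator 1 x = 0 := by
    rw [lintegral_indicator_one hNm]
    exact Measure.restrict_apply_le _ _ |>.trans_eq hN0 |> nonpos_iff_eq_zero.1
  rw [h0, eq_comm, lintegral_eq_zero_iff (by
    refine Measurable.mul (by fun_prop) ?_
    exact (measurable_one.indicator hNm).comp (measurable_orthantChart ε))] at h
  filter_upwards [h] with y hy
  by_contra hcon
  have : orthantChart C ε y ∈ N := hN hcon
  simp [this] at hy
  exact absurd hy (Real.exp_pos _).not_ge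

lemma orthantChart_add (ε : Fin n → ℤˣ) (y b : EuclideanSpace ℝ (Fin n)) (hC : C * Cᵀ = 1) :
    orthantChart C ε (y + b) =
      (C⁻¹ * Matrix.diagonal (fun j => Real.exp (b j)) * C) *ᵥ orthantChart C ε y := by
  rw [← Matrix.mulVec_mulVec, mulVec_orthantChart hC, ← Matrix.mulVec_mulVec,
    Matrix.inv_eq_right_inv hC, orthantChart]
  congr 1
  ext j
  simp [Matrix.mulVec_diagonal, Real.exp_add]
  ring

end Charts

section Transfer

variable {n : ℕ} {C : Matrix (Fin n) (Fin n) ℝ}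

lemma ae_of_ae_orthantChart (hC : C * Cᵀ = 1) {p : (Fin n → ℝ) → Prop}
    (hpm : MeasurableSet {x | p x}) (hp : ∀ ε, ∀ᵐ y, p (orthantChart C ε y)) : ∀ᵐ x, p x := by
  have h : ∀ ε, ∀ᵐ x, x ∈ orthant C ε → p x := by
    intro ε
    have h := setLIntegral_orthant hC ε ({x | p x}ᶜ.indicator 1)
    rw [lintegral_indicator_one hpm.compl, lintegral_congr_ae (g := fun _ => 0), lintegral_zero] at h
    · exact (ae_restrict_iff' (measurableSet_orthant ε)).1 h
    · filter_upwards [hp ε] with y hy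
      simp [hy]
  filter_upwards [ae_all_iff.2 h, ae_mem_orthant hC] with x hx ⟨ε, hε⟩ using hx ε hε

lemma memLp_two_iff_lintegral_enorm_sq {α : Type*} [MeasurableSpace α] {μ : Measure α} {f : α → ℂ}
    (hf : AEStronglyMeasurable f μ) : MemLp f 2 μ ↔ ∫⁻ x, ‖f x‖ₑ ^ 2 ∂μ < ∞ := by
  rw [MemLp, and_iff_right hf, eLpNorm_lt_top_iff_lintegral_rpow_enorm_lt_top two_ne_zero
    ENNReal.ofNat_ne_top]
  simp

/-- The square root of the Jacobian of the logarithmic charts. -/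
noncomputable def chartWeight (y : EuclideanSpace ℝ (Fin n)) : ℂ :=
  (Real.exp ((∑ j, y j) / 2) : ℂ)

lemma chartWeight_ne_zero (y : EuclideanSpace ℝ (Fin n)) : chartWeight y ≠ 0 := by
  simp [chartWeight]

lemma enorm_chartWeight_sq (y : EuclideanSpace ℝ (Fin n)) :
    ‖chartWeight y‖ₑ ^ 2 = ENNReal.ofReal (Real.exp (∑ j, y j)) := by
  rw [chartWeight, ← ofReal_norm, ← ENNReal.ofReal_pow (norm_nonneg _), Complex.norm_real,
    Real.norm_of_nonneg (Real.exp_pos _).le, ← Real.exp_nat_mul]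
  congr 2
  push_cast
  ring

lemma measurable_chartWeight : Measurable (chartWeight (n := n)) := by
  unfold chartWeight
  fun_prop

lemma memLp_orthantChart_iff (hC : C * Cᵀ = 1) (ε : Fin n → ℤˣ) {G : (Fin n → ℝ) → ℂ}
    (hG : Measurable G) :
    MemLp (fun y => chartWeight y * G (orthantChart C ε y)) 2 volume ↔
      MemLp G 2 (volume.restrict (orthant C ε)) := by
  have hm : Measurable fun y => chartWeight y * G (orthantChart C ε y) :=
    measurable_chartWeight.mul (hG.comp (measurable_orthantChart ε))
  rw [memLp_two_iff_lintegral_enorm_sq hG.aestronglyMeasurable,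
    memLp_two_iff_lintegral_enorm_sq hm.aestronglyMeasurable, setLIntegral_orthant hC]
  simp only [enorm_mul, mul_pow, enorm_chartWeight_sq]

lemma exists_orthant_transfer (hC : C * Cᵀ = 1) :
    ∃ V : Lp ℂ 2 (volume : Measure (Fin n → ℝ)) →
        (Fin n → ℤˣ) → Lp ℂ 2 (volume : Measure (EuclideanSpace ℝ (Fin n))),
      Function.Bijective V ∧
        ∀ f ε, V f ε =ᵐ[volume] fun y => chartWeight y * f (orthantChart C ε y) := by
  have hmem (f : Lp ℂ 2 (volume : Measure (Fin n → ℝ))) (ε : Fin n → ℤˣ) :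
      MemLp (fun y => chartWeight y * f (orthantChart C ε y)) 2 volume :=
    (memLp_orthantChart_iff hC ε (Lp.stronglyMeasurable f).measurable).2 ((Lp.memLp f).restrict _)
  refine ⟨fun f ε => (hmem f ε).toLp _, ⟨fun f g hfg => ?_, fun g => ?_⟩,
    fun f ε => (hmem f ε).coeFn_toLp⟩
  · refine Lp.ext (ae_of_ae_orthantChart hC ?_ fun ε => ?_)
    · exact measurableSet_eq_fun (Lp.stronglyMeasurable f).measurable
        (Lp.stronglyMeasurable g).measurable
    · have h := (MemLp.toLp_eq_toLp_iff (hmem f ε) (hmem g ε)).1 (congrFun hfg ε)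
      filter_upwards [h] with y hy using mul_left_cancel₀ (chartWeight_ne_zero y) hy
  · let G (ε : Fin n → ℤˣ) (x : Fin n → ℝ) : ℂ :=
      (chartWeight (orthantCoord C x))⁻¹ * g ε (orthantCoord C x)
    have hGm (ε) : Measurable (G ε) :=
      ((measurable_chartWeight.comp measurable_orthantCoord).inv).mul
        ((Lp.stronglyMeasurable (g ε)).measurable.comp measurable_orthantCoord)
    have hG (ε ε' : Fin n → ℤˣ) (y : EuclideanSpace ℝ (Fin n)) :
        chartWeight y * G ε (orthantChart C ε' y) = g ε y := by
      simp only [G, orthantCoord_orthantChart hC]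
      rw [mul_inv_cancel_left₀ (chartWeight_ne_zero y)]
    have hGmem (ε) : MemLp ((orthant C ε).indicator (G ε)) 2 volume := by
      rw [memLp_indicator_iff_restrict (measurableSet_orthant ε),
        ← memLp_orthantChart_iff hC ε (hGm ε)]
      simp only [hG]
      exact Lp.memLp _
    have hsum := memLp_finsetSum Finset.univ fun ε _ => hGmem ε
    refine ⟨hsum.toLp _, funext fun ε => Lp.ext ?_⟩
    refine (MemLp.coeFn_toLp _).trans ?_
    filter_upwards [ae_orthantChart hC ε hsum.coeFn_toLp] with y hy
    rw [hy, Finset.sum_eq_single ε, Set.indicator_of_mem, hG]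
    · exact (orthantChart_mem_orthant_iff hC _ _ _).2 rfl
    · intro ε' _ hne
      exact Set.indicator_of_notMem (fun h => hne ((orthantChart_mem_orthant_iff hC _ _ _).1 h)) _
    · simp

end Transfer

section Multiplier

variable {E : Type*} [MeasurableSpace E]

/-- Multiplication by a bounded measurable function on `L²`. -/
lemma exists_mul_clm {μ : Measure E} {ψ : E → ℂ} (hψ : Measurable ψ) {K : ℝ}
    (hK : ∀ x, ‖ψ x‖ ≤ K) :
    ∃ M : Lp ℂ 2 μ →L[ℂ] Lp ℂ 2 μ, ∀ f, M f =ᵐ[μ] fun x => ψ x * f x := by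
  have hmem : MemLp ψ ∞ μ :=
    memLp_top_of_bound hψ.aestronglyMeasurable K (Eventually.of_forall hK)
  refine ⟨(ContinuousLinearMap.mul ℂ ℂ).holderL μ ∞ 2 2 hmem.toLp, fun f => ?_⟩
  have h := ContinuousLinearMap.coeFn_holder (r := 2) (ContinuousLinearMap.mul ℂ ℂ) hmem.toLp f
  filter_upwards [h, hmem.coeFn_toLp] with x hx hx'
  simpa [hx'] using hx

/-- Multiplication by a bounded continuous function is bijective on `L²` if and only if the
function is bounded away from zero. -/
lemma bijective_mul_iff [TopologicalSpace E] [BorelSpace E] [Nonempty E]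
    {μ : Measure E} [IsLocallyFiniteMeasure μ] [μ.IsOpenPosMeasure]
    {ψ : E → ℂ} (hψ : Continuous ψ)
    (M : Lp ℂ 2 μ →L[ℂ] Lp ℂ 2 μ) (hM : ∀ f, M f =ᵐ[μ] fun x => ψ x * f x) :
    Function.Bijective M ↔ 0 < ⨅ x, ‖ψ x‖ := by
  constructor
  · intro hbij
    let e := ContinuousLinearEquiv.ofBijective M
      (LinearMap.ker_eq_bot.2 hbij.1) (LinearMap.range_eq_top.2 hbij.2)
    set D : ℝ := ‖(e.symm : Lp ℂ 2 μ →L[ℂ] Lp ℂ 2 μ)‖ + 1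
    have hD : 0 < D := by positivity
    have hle (f : Lp ℂ 2 μ) : ‖f‖ ≤ D * ‖M f‖ := by
      have h := (e.symm : Lp ℂ 2 μ →L[ℂ] Lp ℂ 2 μ).le_opNorm (e f)
      rw [ContinuousLinearEquiv.coe_coe, e.symm_apply_apply] at h
      exact h.trans (mul_le_mul_of_nonneg_right (by simp [D]) (norm_nonneg _))
    refine lt_of_lt_of_le (b := (2 * D)⁻¹) (by positivity) (le_ciInf fun x => ?_)
    by_contra! hx
    have hU : IsOpen {y | ‖ψ y‖ < (2 * D)⁻¹} := isOpen_lt hψ.norm continuous_const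
    obtain ⟨s, hxs, hs, hsμ⟩ := μ.exists_isOpen_measure_lt_top x
    have hso := hs.inter hU
    have hfin : μ (s ∩ {y | ‖ψ y‖ < (2 * D)⁻¹}) ≠ ∞ :=
      ((measure_mono Set.inter_subset_left).trans_lt hsμ).ne
    have hpos : 0 < μ (s ∩ {y | ‖ψ y‖ < (2 * D)⁻¹}) := hso.measure_pos μ ⟨x, hxs, hx⟩
    set g : Lp ℂ 2 μ := indicatorConstLp 2 hso.measurableSet hfin 1
    have hg : 0 < ‖g‖ := by
      rw [norm_indicatorConstLp two_ne_zero ENNReal.ofNat_ne_top, norm_one, one_mul]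
      exact Real.rpow_pos_of_pos (ENNReal.toReal_pos hpos.ne' hfin) _
    have hMg : ‖M g‖ ≤ (2 * D)⁻¹ * ‖g‖ := by
      refine Lp.norm_le_mul_norm_of_ae_le_mul ?_
      filter_upwards [hM g, indicatorConstLp_coeFn (p := 2) (hs := hso.measurableSet) (hμs := hfin)
        (c := (1 : ℂ))] with y hy hy'
      rw [hy, norm_mul]
      by_cases hyU : y ∈ s ∩ {y | ‖ψ y‖ < (2 * D)⁻¹}
      · exact mul_le_mul_of_nonneg_right hyU.2.le (norm_nonneg _)
      · rw [hy', Set.indicator_of_notMem hyU]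
        simp
    have := hle g
    have h2 : D * ‖M g‖ ≤ D * ((2 * D)⁻¹ * ‖g‖) := mul_le_mul_of_nonneg_left hMg hD.le
    have h3 : D * ((2 * D)⁻¹ * ‖g‖) = ‖g‖ / 2 := by field_simp
    linarith
  · intro hpos
    set c := ⨅ x, ‖ψ x‖
    have hc (x) : c ≤ ‖ψ x‖ := ciInf_le ⟨0, by rintro _ ⟨y, rfl⟩; exact norm_nonneg _⟩ x
    have hne (x) : ψ x ≠ 0 := norm_pos_iff.1 (hpos.trans_le (hc x))
    obtain ⟨N, hN⟩ := exists_mul_clm (μ := μ) (ψ := fun x => (ψ x)⁻¹) hψ.measurable.inv (K := c⁻¹)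
      (fun x => by rw [norm_inv]; exact inv_anti₀ hpos (hc x))
    refine Function.bijective_iff_has_inverse.2 ⟨N, fun f => Lp.ext ?_, fun f => Lp.ext ?_⟩
    · filter_upwards [hN (M f), hM f] with x h1 h2
      rw [h1, h2, inv_mul_cancel_left₀ (hne x)]
    · filter_upwards [hM (N f), hN f] with x h1 h2
      rw [h1, h2, mul_inv_cancel_left₀ (hne x)]

end Multiplier

section Translation

variable {Ω : Type*} [MeasurableSpace Ω] {μ : Measure Ω}

lemma ae_ae_add [SFinite μ] {E : Type*} [MeasurableSpace E] [AddGroup E] [MeasurableAdd₂ E]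
    {ν : Measure E} [SFinite ν] [ν.IsAddRightInvariant] {b : Ω → E} (hb : Measurable b)
    {p : E → Prop} (hp : ∀ᵐ y ∂ν, p y) : ∀ᵐ y ∂ν, ∀ᵐ u ∂μ, p (y + b u) := by
  obtain ⟨N, hN, hNm, hN0⟩ := exists_measurable_superset_of_null (ae_iff.1 hp)
  have hm : MeasurableSet {z : E × Ω | z.1 + b z.2 ∈ N} :=
    (measurable_fst.add (hb.comp measurable_snd)) hNm
  have h0 : ∀ᵐ z ∂ν.prod μ, z.1 + b z.2 ∉ N := by
    rw [ae_iff]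
    simp only [not_not]
    rw [Measure.prod_apply_symm hm]
    refine lintegral_eq_zero_of_ae_eq_zero (Eventually.of_forall fun u => ?_)
    exact (measure_preimage_add_right ν (b u) N).trans hN0
  filter_upwards [Measure.ae_ae_of_ae_prod h0] with y hy
  filter_upwards [hy] with u hu
  by_contra hcon
  exact hu (hN hcon)

variable {E : Type*} [NormedAddCommGroup E] [InnerProductSpace ℝ E] [FiniteDimensional ℝ E]
  [MeasurableSpace E] [BorelSpace E]

open scoped FourierTransform ComplexInnerProductSpace

/-- The Fourier multiplier of the operator `g ↦ ∫ u, k u * g (· + b u) ∂μ`. -/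
noncomputable def translationSymbol (μ : Measure Ω) (k : Ω → ℂ) (b : Ω → E) (ξ : E) : ℂ :=
  ∫ u, ((Real.fourierChar (inner ℝ (b u) ξ) : Circle) : ℂ) * k u ∂μ

omit [FiniteDimensional ℝ E] [MeasurableSpace E] [BorelSpace E] in
lemma norm_translationSymbol_le (k : Ω → ℂ) (b : Ω → E) (ξ : E) :
    ‖translationSymbol μ k b ξ‖ ≤ ∫ u, ‖k u‖ ∂μ := by
  refine (norm_integral_le_integral_norm _).trans_eq (integral_congr_ae ?_)
  refine Eventually.of_forall fun u => ?_
  dsimp only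
  rw [norm_mul, Circle.norm_coe, one_mul]

lemma continuous_translationSymbol {k : Ω → ℂ} (hk : Integrable k μ) {b : Ω → E}
    (hb : Measurable b) : Continuous (translationSymbol μ k b) := by
  refine continuous_of_dominated (bound := fun u => ‖k u‖) (fun ξ => ?_) (fun ξ => ?_) hk.norm ?_
  · refine AEStronglyMeasurable.mul ?_ hk.aestronglyMeasurable
    exact (Measurable.aestronglyMeasurable (by fun_prop))
  · refine Eventually.of_forall fun u => ?_
    rw [norm_mul, Circle.norm_coe, one_mul]
  · refine Eventually.of_forall fun u => ?_
    fun_prop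

lemma integrable_mul_translate [SFinite μ] {k : Ω → ℂ} (hk : Integrable k μ) {b : Ω → E}
    (hb : Measurable b) {θ g : E → ℂ} (hθ : MemLp θ 2) (hg : MemLp g 2) (hgm : Measurable g) :
    Integrable (fun z : E × Ω => θ z.1 * (k z.2 * g (z.1 + b z.2))) (volume.prod μ) := by
  have hgt (u : Ω) : MemLp (fun y => g (y + b u)) 2 :=
    hg.comp_measurePreserving (measurePreserving_add_right volume (b u))
  have hnorm (u : Ω) : eLpNorm (fun y => g (y + b u)) 2 volume = eLpNorm g 2 volume :=
    eLpNorm_comp_measurePreserving hg.1 (measurePreserving_add_right volume (b u))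
  have hmeas : AEStronglyMeasurable
      (fun z : E × Ω => θ z.1 * (k z.2 * g (z.1 + b z.2))) (volume.prod μ) := by
    refine hθ.1.comp_fst.mul (hk.1.comp_snd.mul ?_)
    exact (hgm.comp (measurable_fst.add (hb.comp measurable_snd))).aestronglyMeasurable
  refine ⟨hmeas, ?_⟩
  rw [HasFiniteIntegral, lintegral_prod_symm _ hmeas.enorm]
  have hle (u : Ω) : ∫⁻ y, ‖θ y * (k u * g (y + b u))‖ₑ ≤
      (eLpNorm θ 2 volume * eLpNorm g 2 volume) * ‖k u‖ₑ := by
    have h := eLpNorm_smul_le_mul_eLpNorm (p := 2) (q := 2) (r := 1) (hgt u).1 hθ.1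
    rw [hnorm, eLpNorm_one_eq_lintegral_enorm] at h
    calc ∫⁻ y, ‖θ y * (k u * g (y + b u))‖ₑ
        = ∫⁻ y, ‖(θ • fun y => g (y + b u)) y‖ₑ * ‖k u‖ₑ := by
          refine lintegral_congr fun y => ?_
          simp only [enorm_mul, Pi.smul_apply', smul_eq_mul]
          ring
      _ ≤ _ := by
          rw [lintegral_mul_const' _ _ enorm_ne_top]
          gcongr
  refine (lintegral_mono hle).trans_lt ?_
  rw [lintegral_const_mul' _ _ (ENNReal.mul_ne_top hθ.2.ne hg.2.ne)]
  exact ENNReal.mul_lt_top (ENNReal.mul_lt_top hθ.2 hg.2) hk.2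

lemma fourier_compSubConst (θ : SchwartzMap E ℂ) (v ξ : E) :
    𝓕 (SchwartzMap.compSubConstCLM ℂ v θ) ξ =
      conj ((Real.fourierChar (inner ℝ v ξ) : Circle) : ℂ) * 𝓕 θ ξ := by
  have h := congrFun (VectorFourier.fourierIntegral_comp_add_right Real.fourierChar volume
    (innerₗ E) (θ : E → ℂ) (-v)) ξ
  rw [SchwartzMap.fourier_coe, SchwartzMap.fourier_coe]
  have hθ : (SchwartzMap.compSubConstCLM ℂ v θ : E → ℂ) = θ ∘ fun y => y + -v := by
    ext y
    simp [sub_eq_add_neg]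
  rw [hθ]
  refine h.trans ?_
  rw [Circle.smul_def, smul_eq_mul, innerₗ_apply_apply, inner_neg_left, AddChar.map_neg_eq_inv,
    Circle.coe_inv_eq_conj]
  rfl


lemma locallyIntegrable_integral_translate [SFinite μ] {k : Ω → ℂ} (hk : Integrable k μ)
    {b : Ω → E} (hb : Measurable b) {g : E → ℂ} (hg : MemLp g 2) (hgm : Measurable g) :
    LocallyIntegrable (fun y => ∫ u, k u * g (y + b u) ∂μ) := by
  rw [locallyIntegrable_iff]
  intro K hK
  have hθ : MemLp (K.indicator fun _ => (1 : ℂ)) 2 (volume : Measure E) :=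
    memLp_indicator_const 2 hK.measurableSet 1 (Or.inr hK.measure_lt_top.ne)
  have h := (integrable_mul_translate hk hb hθ hg hgm).integral_prod_left
  rw [← integrable_indicator_iff hK.measurableSet]
  refine h.congr (Eventually.of_forall fun y => ?_)
  by_cases hy : y ∈ K <;> simp [hy]

/-- A superposition of translations acts on `L²` as a Fourier multiplier. -/
lemma fourierInv_translationSymbol_mul [SFinite μ] {k : Ω → ℂ} (hk : Integrable k μ) {b : Ω → E}
    (hb : Measurable b) (g m : Lp ℂ 2 (volume : Measure E))
    (hm : m =ᵐ[volume] fun ξ => translationSymbol μ k b ξ * (𝓕 g : Lp ℂ 2 (volume : Measure E)) ξ) :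
    (𝓕⁻ m : Lp ℂ 2 (volume : Measure E)) =ᵐ[volume] fun y => ∫ u, k u * g (y + b u) ∂μ := by
  have hgm := (Lp.stronglyMeasurable g).measurable
  have hFgm := (Lp.stronglyMeasurable (𝓕 g : Lp ℂ 2 (volume : Measure E))).measurable
  refine ae_eq_of_integral_contDiff_smul_eq
    ((Lp.memLp (𝓕⁻ m)).locallyIntegrable one_le_two)
    (locallyIntegrable_integral_translate hk hb (Lp.memLp g) hgm) fun θ₀ hθ₀ hθ₀c => ?_
  have hθd : ContDiff ℝ (⊤ : ℕ∞) fun y => (θ₀ y : ℂ) := Complex.ofRealCLM.contDiff.comp hθ₀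
  have hθc : HasCompactSupport fun y => (θ₀ y : ℂ) := hθ₀c.comp_left Complex.ofReal_zero
  let θ : SchwartzMap E ℂ := hθc.toSchwartzMap hθd
  have hθ (y : E) : θ y = θ₀ y := rfl
  have hinner (v : E) : ⟪(SchwartzMap.compSubConstCLM ℂ v θ).toLp 2, g⟫ =
      ∫ y, θ y * g (y + v) := by
    rw [L2.inner_def, ← integral_add_right_eq_self _ v]
    refine integral_congr_ae ?_
    have h := (SchwartzMap.compSubConstCLM ℂ v θ).coeFn_toLp 2 (volume : Measure E)
    filter_upwards [(measurePreserving_add_right volume v).quasiMeasurePreserving.ae h] with y hy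
    rw [hy]
    simp [hθ, mul_comm]
  have hinner' (v : E) : ⟪(SchwartzMap.compSubConstCLM ℂ v θ).toLp 2, g⟫ =
      ∫ ξ, conj (𝓕 θ ξ) * (((Real.fourierChar (inner ℝ v ξ) : Circle) : ℂ) *
        (𝓕 g : Lp ℂ 2 (volume : Measure E)) ξ) := by
    rw [← Lp.inner_fourier_eq, SchwartzMap.toLp_fourier_eq, L2.inner_def]
    refine integral_congr_ae ?_
    filter_upwards [(𝓕 (SchwartzMap.compSubConstCLM ℂ v θ)).coeFn_toLp 2 (volume : Measure E)]
      with ξ hξ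
    rw [hξ, fourier_compSubConst, RCLike.inner_apply, map_mul, Complex.conj_conj]
    ring
  have hFinv : 𝓕 (𝓕⁻ m : Lp ℂ 2 (volume : Measure E)) = m :=
    FourierTransform.fourier_fourierInv_eq m
  have hL : ∫ y, θ₀ y • (𝓕⁻ m : Lp ℂ 2 (volume : Measure E)) y =
      ∫ ξ, conj (𝓕 θ ξ) * (translationSymbol μ k b ξ *
        (𝓕 g : Lp ℂ 2 (volume : Measure E)) ξ) := by
    have h1 : ∫ y, θ₀ y • (𝓕⁻ m : Lp ℂ 2 (volume : Measure E)) y =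
        ⟪θ.toLp 2, (𝓕⁻ m : Lp ℂ 2 (volume : Measure E))⟫ := by
      rw [L2.inner_def]
      refine integral_congr_ae ?_
      filter_upwards [θ.coeFn_toLp 2 (volume : Measure E)] with y hy
      rw [hy, hθ]
      simp [mul_comm]
    rw [h1, ← Lp.inner_fourier_eq, SchwartzMap.toLp_fourier_eq, hFinv,
      L2.inner_def]
    refine integral_congr_ae ?_
    filter_upwards [(𝓕 θ).coeFn_toLp 2 (volume : Measure E), hm] with ξ hξ hξ'
    rw [hξ, hξ', RCLike.inner_apply]
    ring
  have hR : ∫ y, θ₀ y • ∫ u, k u * g (y + b u) ∂μ =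
      ∫ u, k u * (∫ y, θ y * g (y + b u)) ∂μ := by
    have h := integral_integral_swap (f := fun y u => θ y * (k u * g (y + b u)))
      (integrable_mul_translate hk hb (θ.memLp 2 volume) (Lp.memLp g) hgm)
    calc ∫ y, θ₀ y • ∫ u, k u * g (y + b u) ∂μ
        = ∫ y, ∫ u, θ y * (k u * g (y + b u)) ∂μ := by
          simp only [integral_const_mul, hθ, Complex.real_smul]
      _ = ∫ u, ∫ y, θ y * (k u * g (y + b u)) ∂volume ∂μ := h
      _ = _ := by
          simp only [← integral_const_mul, mul_left_comm]
  rw [hL, hR]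
  simp only [← hinner, hinner']
  have hint : Integrable (fun ξ => conj (𝓕 θ ξ) * (𝓕 g : Lp ℂ 2 (volume : Measure E)) ξ) :=
    ((𝓕 θ).memLp 2 volume).star.integrable_mul (Lp.memLp _)
  have hint' : Integrable (fun z : E × Ω => conj (𝓕 θ z.1) *
      (((Real.fourierChar (inner ℝ (b z.2) z.1) : Circle) : ℂ) * k z.2 *
        (𝓕 g : Lp ℂ 2 (volume : Measure E)) z.1)) (volume.prod μ) := by
    refine (hint.mul_prod hk).mono ?_ (Eventually.of_forall fun z => ?_)
    · refine (Complex.continuous_conj.measurable.comp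
        ((𝓕 θ).continuous.measurable.comp measurable_fst)).aestronglyMeasurable.mul
        ((AEStronglyMeasurable.mul ?_ hk.1.comp_snd).mul
          (hFgm.comp measurable_fst).aestronglyMeasurable)
      exact Measurable.aestronglyMeasurable (by fun_prop)
    · simp only [norm_mul]
      rw [Circle.norm_coe]
      apply le_of_eq
      ring
  calc _ = ∫ ξ, ∫ u, conj (𝓕 θ ξ) * (((Real.fourierChar (inner ℝ (b u) ξ) : Circle) : ℂ) * k u *
        (𝓕 g : Lp ℂ 2 (volume : Measure E)) ξ) ∂μ := by
        simp only [integral_const_mul, integral_mul_const, translationSymbol]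
    _ = _ := integral_integral_swap hint'
    _ = _ := by
        simp only [← integral_const_mul]
        refine integral_congr_ae (Eventually.of_forall fun u => integral_congr_ae
          (Eventually.of_forall fun ξ => ?_))
        dsimp only
        ring

end Translation

section Hausdorff

lemma bijective_iff_of_conj_pi {α β ι : Type*} [Nonempty ι] {T : α → α} {M : β → β}
    {V : α → ι → β} (hV : Function.Bijective V) (h : ∀ f i, V (T f) i = M (V f i)) :
    Function.Bijective T ↔ Function.Bijective M := by
  have hcomp : V ∘ T = (fun g i => M (g i)) ∘ V := by
    ext f i
    exact h f i
  rw [← Function.Bijective.of_comp_iff' hV, hcomp, Function.Bijective.of_comp_iff _ hV]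
  refine ⟨fun hM => ⟨fun x y hxy => ?_, fun x => ?_⟩, fun hM => Function.Bijective.piMap fun _ => hM⟩
  · exact congrFun (hM.1 (a₁ := fun _ => x) (a₂ := fun _ => y) (funext fun _ => hxy))
      (Classical.arbitrary ι)
  · obtain ⟨g, hg⟩ := hM.2 fun _ => x
    exact ⟨g (Classical.arbitrary ι), congrFun hg _⟩

lemma exists_memLp_two_forall_ne_zero {α : Type*} [MeasurableSpace α] (μ : Measure α)
    [SigmaFinite μ] : ∃ g : α → ℂ, Measurable g ∧ (∀ x, g x ≠ 0) ∧ MemLp g 2 μ := by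
  obtain ⟨w, hw, hwm, hwi⟩ := exists_pos_lintegral_lt_of_sigmaFinite μ one_ne_zero
  have hm : Measurable fun x => ((NNReal.sqrt (w x) : ℝ) : ℂ) :=
    Complex.measurable_ofReal.comp (NNReal.continuous_sqrt.measurable.comp hwm).coe_nnreal_real
  refine ⟨_, hm, fun x => ?_, (memLp_two_iff_lintegral_enorm_sq hm.aestronglyMeasurable).2 ?_⟩
  · simpa using (hw x).ne'
  · refine lt_of_eq_of_lt (lintegral_congr fun x => ?_) (hwi.trans ENNReal.one_lt_top)
    rw [← ofReal_norm, Complex.norm_real, NNReal.norm_eq, ENNReal.ofReal_coe_nnreal]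
    norm_cast
    exact NNReal.sq_sqrt _

variable {Ω : Type*} {n : ℕ} {Φ : Ω → ℂ} {a : Fin n → Ω → ℝ} {u : Ω}

/-- The logarithms of the eigenvalues of the dilation. -/
noncomputable def logDilation (a : Fin n → Ω → ℝ) (u : Ω) : EuclideanSpace ℝ (Fin n) :=
  WithLp.toLp 2 fun j => Real.log (a j u)

/-- The kernel of a Hausdorff operator, normalized by the square root of the determinant of the
dilation. -/
noncomputable def dilationKernel (Φ : Ω → ℂ) (a : Fin n → Ω → ℝ) (u : Ω) : ℂ :=
  Φ u * (((∏ j, a j u) ^ (-((1 : ℝ) / 2)) : ℝ) : ℂ)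

lemma measurable_logDilation [MeasurableSpace Ω] (ha : ∀ j, Measurable (a j)) :
    Measurable (logDilation a) :=
  (WithLp.measurable_toLp 2 _).comp (measurable_pi_lambda _ fun j => (ha j).log)

lemma prod_rpow_eq_exp (hpos : ∀ j, 0 < a j u) :
    (∏ j, a j u) ^ (-((1 : ℝ) / 2)) = Real.exp (-(∑ j, logDilation a u j) / 2) := by
  rw [Real.rpow_def_of_pos (Finset.prod_pos fun j _ => hpos j),
    Real.log_prod fun j _ => (hpos j).ne']
  congr 1
  simp only [logDilation]
  ring

lemma chartWeight_mul_apply_dilation {C : Matrix (Fin n) (Fin n) ℝ} (hC : C * Cᵀ = 1)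
    {A : Matrix (Fin n) (Fin n) ℝ} (hpos : ∀ j, 0 < a j u)
    (hA : A = C⁻¹ * Matrix.diagonal (fun j => a j u) * C) (ε : Fin n → ℤˣ) (f : (Fin n → ℝ) → ℂ)
    (y : EuclideanSpace ℝ (Fin n)) :
    chartWeight y * (Φ u * f (A *ᵥ orthantChart C ε y)) =
      dilationKernel Φ a u * (chartWeight (y + logDilation a u) *
        f (orthantChart C ε (y + logDilation a u))) := by
  have hexp : (fun j => Real.exp (logDilation a u j)) = fun j => a j u :=
    funext fun j => Real.exp_log (hpos j)
  have hw : chartWeight y = (((∏ j, a j u) ^ (-((1 : ℝ) / 2)) : ℝ) : ℂ) *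
      chartWeight (y + logDilation a u) := by
    rw [prod_rpow_eq_exp hpos, chartWeight, chartWeight, ← Complex.ofReal_mul, ← Real.exp_add]
    congr 2
    simp only [PiLp.add_apply, Finset.sum_add_distrib]
    ring
  rw [orthantChart_add _ _ _ hC, hexp, ← hA, hw, dilationKernel]
  ring

lemma prod_cpow_eq (hpos : ∀ j, 0 < a j u) (ξ : EuclideanSpace ℝ (Fin n)) :
    Φ u * ∏ j, (a j u : ℂ) ^ (-(1 / 2 : ℂ) - Complex.I * ((-2 * Real.pi * ξ j : ℝ) : ℂ)) =
      ((Real.fourierChar (inner ℝ (logDilation a u) ξ) : Circle) : ℂ) * dilationKernel Φ a u := by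
  have h (j) : (a j u : ℂ) ^ (-(1 / 2 : ℂ) - Complex.I * ((-2 * Real.pi * ξ j : ℝ) : ℂ)) =
      Complex.exp ((Real.log (a j u) : ℂ) *
        (-(1 / 2 : ℂ) - Complex.I * ((-2 * Real.pi * ξ j : ℝ) : ℂ))) := by
    rw [Complex.cpow_def_of_ne_zero (by exact_mod_cast (hpos j).ne'),
      Complex.ofReal_log (hpos j).le]
  rw [Finset.prod_congr rfl fun j _ => h j, ← Complex.exp_sum, Real.fourierChar_apply,
    dilationKernel, prod_rpow_eq_exp hpos, Complex.ofReal_exp, mul_left_comm, ← Complex.exp_add]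
  congr 2
  simp only [PiLp.inner_apply, logDilation, RCLike.inner_apply, conj_trivial]
  push_cast
  simp only [Finset.mul_sum, Finset.sum_mul, Finset.sum_div, ← Finset.sum_neg_distrib,
    ← Finset.sum_add_distrib]
  refine Finset.sum_congr rfl fun j _ => ?_
  ring

end Hausdorff

/-- A normal Hausdorff operator on `L²(ℝⁿ)` is invertible if and only if the infimum of the
modulus of its symbol is positive. -/
theorem hausdorff_invertible_iff {Ω : Type*} [MeasurableSpace Ω] (μ : Measure Ω)
    [SigmaFinite μ] (n : ℕ)
    (Φ : Ω → ℂ) (A : Ω → Matrix (Fin n) (Fin n) ℝ)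
    (C : Matrix (Fin n) (Fin n) ℝ) (hC : C * Cᵀ = 1)
    (a : Fin n → Ω → ℝ) (ha : ∀ j, Measurable (a j))
    (hapos : ∀ᵐ u ∂μ, Φ u ≠ 0 → ∀ j, 0 < a j u)
    (hdiag : ∀ᵐ u ∂μ, Φ u ≠ 0 → A u = C⁻¹ * Matrix.diagonal (fun j => a j u) * C)
    (hint : Integrable (fun u => ‖Φ u‖ * (∏ j, a j u) ^ (-((1 : ℝ) / 2))) μ)
    (T : Lp ℂ 2 (volume : Measure (Fin n → ℝ)) →L[ℂ] Lp ℂ 2 (volume : Measure (Fin n → ℝ)))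
    (hT : ∀ f : Lp ℂ 2 (volume : Measure (Fin n → ℝ)),
      ∀ᵐ x : Fin n → ℝ ∂volume, T f x = ∫ u, Φ u * f ((A u).mulVec x) ∂μ)
    (φ : (Fin n → ℝ) → ℂ)
    (hφ : ∀ s : Fin n → ℝ,
      φ s = ∫ u, Φ u * ∏ j, (a j u : ℂ) ^ (-(1 / 2 : ℂ) - Complex.I * (s j : ℂ)) ∂μ) :
    Function.Bijective T ↔ 0 < ⨅ s : Fin n → ℝ, ‖φ s‖ := by
  have hb := measurable_logDilation ha
  obtain ⟨V, hV, hVf⟩ := exists_orthant_transfer hC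
  have hVT (f : Lp ℂ 2 (volume : Measure (Fin n → ℝ))) (ε : Fin n → ℤˣ) :
      V (T f) ε =ᵐ[volume] fun y =>
        ∫ u, dilationKernel Φ a u * V f ε (y + logDilation a u) ∂μ := by
    filter_upwards [hVf (T f) ε, ae_orthantChart hC ε (hT f),
      ae_ae_add (μ := μ) hb (hVf f ε)] with y h1 h2 h3
    rw [h1, h2, ← integral_const_mul]
    refine integral_congr_ae ?_
    filter_upwards [hapos, hdiag, h3] with u hu hu' hu3
    rw [hu3]
    rcases eq_or_ne (Φ u) 0 with h0 | h0
    · simp [h0, dilationKernel]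
    · exact chartWeight_mul_apply_dilation hC (hu h0) (hu' h0) ε f y
  have hsymbol (ξ : EuclideanSpace ℝ (Fin n)) :
      φ (fun j => -2 * Real.pi * ξ j) =
        translationSymbol μ (dilationKernel Φ a) (logDilation a) ξ := by
    rw [hφ, translationSymbol]
    refine integral_congr_ae ?_
    filter_upwards [hapos] with u hu
    rcases eq_or_ne (Φ u) 0 with h0 | h0
    · simp [h0, dilationKernel]
    · exact prod_cpow_eq (hu h0) ξ
  have hinf : ⨅ s, ‖φ s‖ =
      ⨅ ξ, ‖translationSymbol μ (dilationKernel Φ a) (logDilation a) ξ‖ := by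
    simp only [← hsymbol]
    refine (Function.Surjective.iInf_comp (g := fun s => ‖φ s‖)
      (f := fun (ξ : EuclideanSpace ℝ (Fin n)) j => -2 * Real.pi * ξ j) fun s => ?_).symm
    refine ⟨WithLp.toLp 2 fun j => s j / (-2 * Real.pi), funext fun j => ?_⟩
    have := Real.pi_ne_zero
    field_simp
  rw [hinf]
  by_cases hkm : AEStronglyMeasurable (dilationKernel Φ a) μ
  · have hk : Integrable (dilationKernel Φ a) μ := by
      refine hint.mono hkm ?_
      filter_upwards with u
      rw [dilationKernel, norm_mul, norm_mul, norm_norm, Complex.norm_real]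
    have hψ := continuous_translationSymbol hk hb
    obtain ⟨M, hM⟩ := exists_mul_clm (μ := (volume : Measure (EuclideanSpace ℝ (Fin n))))
      hψ.measurable (norm_translationSymbol_le _ _)
    let F := Lp.fourierTransformₗᵢ (EuclideanSpace ℝ (Fin n)) ℂ
    have hconj := bijective_iff_of_conj_pi (T := T) (M := F.symm ∘ M ∘ F) hV fun f ε =>
      Lp.ext ((hVT f ε).trans (fourierInv_translationSymbol_mul hk hb (V f ε) _ (hM _)).symm)
    rw [hconj, Function.Bijective.of_comp_iff' F.symm.bijective,
      Function.Bijective.of_comp_iff _ F.bijective, bijective_mul_iff hψ M hM]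
  · have hzero (ξ) : translationSymbol μ (dilationKernel Φ a) (logDilation a) ξ = 0 := by
      refine integral_non_aestronglyMeasurable fun h => hkm ?_
      have hχ : Measurable fun u => conj
          ((Real.fourierChar (inner ℝ (logDilation a u) ξ) : Circle) : ℂ) :=
        Complex.continuous_conj.measurable.comp (by fun_prop)
      refine (hχ.aestronglyMeasurable.mul h).congr (Eventually.of_forall fun u => ?_)
      simp only [Pi.mul_apply]
      rw [← mul_assoc, ← Complex.normSq_eq_conj_mul_self, Circle.normSq_coe, Complex.ofReal_one,
        one_mul]
    refine iff_of_false (fun hbij => ?_) (by simp [hzero])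
    obtain ⟨g, hgm, hg0, hg⟩ :=
      exists_memLp_two_forall_ne_zero (volume : Measure (EuclideanSpace ℝ (Fin n)))
    obtain ⟨f, hf⟩ := hV.2 fun _ => hg.toLp
    have hVT0 (ε) : V (T f) ε =ᵐ[volume] 0 := by
      filter_upwards [hVT f ε, ae_ae_add (μ := μ) hb hg.coeFn_toLp] with y hy hy'
      rw [hy, hf]
      refine integral_non_aestronglyMeasurable fun h => hkm ?_
      have hgt : Measurable fun u => (g (y + logDilation a u))⁻¹ :=
        (hgm.comp (hb.const_add y)).inv
      refine (h.mul hgt.aestronglyMeasurable).congr ?_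
      filter_upwards [hy'] with u hu
      simp only [Pi.mul_apply]
      rw [hu, mul_inv_cancel_right₀ (hg0 _)]
    have hV0 (ε) : V 0 ε =ᵐ[volume] 0 := by
      filter_upwards [hVf 0 ε, ae_orthantChart hC ε (Lp.coeFn_zero ℂ 2 volume)] with y h1 h2
      rw [h1, h2]
      simp
    have hf0 : f = 0 := by
      refine hbij.1 (hV.1 (funext fun ε => Lp.ext ?_))
      rw [map_zero]
      exact (hVT0 ε).trans (hV0 ε).symm
    have hg_zero : ∀ᵐ y : EuclideanSpace ℝ (Fin n), False := by
      filter_upwards [hg.coeFn_toLp, hV0 1] with y h1 h2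
      rw [← hf0, hf, h1] at h2
      exact hg0 y h2
    exact (hg_zero.exists).choose_spec
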